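/- Let U ≥ 2, c > 0, and let X_1,…,X_U be points in the plane whose pairwise distances satisfy |X_k − X_j| ≥ d_min > 0 for all k ≠ j. Define Φ(Y) = |Σ_{u=1}^{U} J₀(c·|X_u − Y|)|. Then for every u, |Φ(X_u) − 1| ≤ 0.7858 · (U − 1) · (c·d_min)^{−1/3}. -/

import Mathlib

open Real Complex

/-- Bessel function of the first kind with integer order `n`, defined by the
integral `J_n(x) = (1/(2π)) ∫₀^{2π} exp(i (x sin φ − n φ)) dφ`
(the integral is real-valued; we take the real-valued cosine form). -/
noncomputable def besselJ (n : ℤ) (x : ℝ) : ℝ :=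
  (1 / (2 * Real.pi)) * ∫ φ in (0:ℝ)..(2 * Real.pi), Real.cos (x * Real.sin φ - n * φ)

/-- The derivative of `besselJ 0`, as an integral. -/
noncomputable def besselJZeroDeriv (x : ℝ) : ℝ :=
  (1 / (2 * Real.pi)) *
    ∫ φ in (0:ℝ)..(2 * Real.pi), -(Real.sin φ * Real.sin (x * Real.sin φ))

theorem besselJ_zero_eq (x : ℝ) :
    besselJ 0 x = (1 / (2 * Real.pi)) *
      ∫ φ in (0:ℝ)..(2 * Real.pi), Real.cos (x * Real.sin φ) := by
  simp [besselJ]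

theorem besselJ_zero_zero : besselJ 0 0 = 1 := by
  rw [besselJ_zero_eq]
  simp
  field_simp

theorem besselJZeroDeriv_zero : besselJZeroDeriv 0 = 0 := by
  simp [besselJZeroDeriv]

theorem besselJ_zero_le_one (x : ℝ) : besselJ 0 x ≤ 1 := by
  rw [← besselJ_zero_zero, besselJ_zero_eq, besselJ_zero_eq]
  apply mul_le_mul_of_nonneg_left _ (by positivity)
  apply intervalIntegral.integral_mono_on (by positivity)
  · exact (by fun_prop : Continuous _).intervalIntegrable _ _
  · exact (by fun_prop : Continuous _).intervalIntegrable _ _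
  · intro φ _
    simpa using Real.cos_le_one _

/-- Differentiation under the integral sign for a jointly continuous, uniformly bounded
derivative. -/
theorem hasDerivAt_intervalIntegral_of_bounded {F F' : ℝ → ℝ → ℝ} {a b C : ℝ}
    (hF : ∀ x, Continuous (F x)) (hF' : ∀ x, Continuous (F' x))
    (hC : ∀ x t, |F' x t| ≤ C) (hd : ∀ x t, HasDerivAt (fun x => F x t) (F' x t) x) (x : ℝ) :
    HasDerivAt (fun x => ∫ t in a..b, F x t) (∫ t in a..b, F' x t) x :=
  (intervalIntegral.hasDerivAt_integral_of_dominated_loc_of_deriv_le (bound := fun _ => C)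
    Filter.univ_mem (.of_forall fun x => (hF x).aestronglyMeasurable)
    ((hF x).intervalIntegrable _ _) (hF' x).aestronglyMeasurable
    (.of_forall fun t _ x _ => hC x t) (by simp)
    (.of_forall fun t _ x _ => hd x t)).2

theorem hasDerivAt_besselJ_zero (x : ℝ) : HasDerivAt (besselJ 0) (besselJZeroDeriv x) x := by
  rw [funext besselJ_zero_eq]
  refine HasDerivAt.const_mul _ (hasDerivAt_intervalIntegral_of_bounded (C := 1)
    (F := fun x φ => Real.cos (x * Real.sin φ))
    (F' := fun x φ => -(Real.sin φ * Real.sin (x * Real.sin φ)))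
    (fun x => by fun_prop) (fun x => by fun_prop) (fun x t => ?_) (fun x t => ?_) x)
  · rw [abs_neg, abs_mul]
    exact mul_le_one₀ (Real.abs_sin_le_one _) (abs_nonneg _) (Real.abs_sin_le_one _)
  · exact ((hasDerivAt_id' x).mul_const (Real.sin t)).cos.congr_deriv (by ring)

/-- Bessel's equation `(x J₀')' = -x J₀`. -/
theorem hasDerivAt_mul_besselJZeroDeriv (x : ℝ) :
    HasDerivAt (fun x => x * besselJZeroDeriv x) (-(x * besselJ 0 x)) x := by
  have h : HasDerivAt besselJZeroDeriv ((1 / (2 * Real.pi)) *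
      ∫ φ in (0:ℝ)..(2 * Real.pi), -(Real.sin φ ^ 2 * Real.cos (x * Real.sin φ))) x := by
    refine HasDerivAt.const_mul _ (hasDerivAt_intervalIntegral_of_bounded (C := 1)
      (F := fun x φ => -(Real.sin φ * Real.sin (x * Real.sin φ)))
      (F' := fun x φ => -(Real.sin φ ^ 2 * Real.cos (x * Real.sin φ)))
      (fun x => by fun_prop) (fun x => by fun_prop) (fun x t => ?_) (fun x t => ?_) x)
    · rw [abs_neg, abs_mul, abs_pow]
      exact mul_le_one₀ (pow_le_one₀ (abs_nonneg _) (Real.abs_sin_le_one _)) (abs_nonneg _)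
        (Real.abs_cos_le_one _)
    · exact (((hasDerivAt_id' x).mul_const (Real.sin t)).sin.const_mul (Real.sin t)).neg.congr_deriv
        (by ring)
  have hFTC : ∫ φ in (0:ℝ)..(2 * Real.pi), (x * Real.cos (x * Real.sin φ)
      - Real.sin φ * Real.sin (x * Real.sin φ)
      - x * (Real.sin φ ^ 2 * Real.cos (x * Real.sin φ))) = 0 := by
    rw [intervalIntegral.integral_eq_sub_of_hasDerivAt
      (f := fun φ => Real.cos φ * Real.sin (x * Real.sin φ))]
    · simp
    · intro φ _
      refine ((Real.hasDerivAt_cos φ).mul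
        ((Real.hasDerivAt_sin φ).const_mul x).sin).congr_deriv ?_
      rw [Real.sin_sq]
      ring
    · exact (by fun_prop : Continuous _).intervalIntegrable _ _
  rw [intervalIntegral.integral_sub, intervalIntegral.integral_sub,
    intervalIntegral.integral_const_mul, intervalIntegral.integral_const_mul] at hFTC
  · refine ((hasDerivAt_id' x).mul h).congr_deriv ?_
    simp only [besselJZeroDeriv, intervalIntegral.integral_neg, besselJ_zero_eq]
    linear_combination (1 / (2 * Real.pi)) * hFTC
  all_goals exact (by fun_prop : Continuous _).intervalIntegrable _ _

theorem nonneg_of_hasDerivAt_nonneg {f f' : ℝ → ℝ} (hf : ∀ x, HasDerivAt f (f' x) x)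
    (h0 : f 0 = 0) (hf' : ∀ x, 0 ≤ x → 0 ≤ f' x) {x : ℝ} (hx : 0 ≤ x) : 0 ≤ f x := by
  rw [← h0]
  refine monotoneOn_of_hasDerivWithinAt_nonneg (convex_Ici 0)
    (fun y _ => (hf y).continuousAt.continuousWithinAt)
    (fun y _ => (hf y).hasDerivWithinAt) (fun y hy => ?_) Set.self_mem_Ici hx hx
  rw [interior_Ici] at hy
  exact hf' y (le_of_lt hy)

/-- The coefficient of `x ^ (2 * k)` in the power series of `besselJ 0`. -/
noncomputable def besselJZeroCoeff (k : ℕ) : ℝ := (-1) ^ k / (4 ^ k * (k.factorial : ℝ) ^ 2)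

/-- The Taylor polynomial of `besselJ 0` with `n` terms. -/
noncomputable def besselJZeroTaylor (n : ℕ) (x : ℝ) : ℝ :=
  ∑ k ∈ Finset.range n, besselJZeroCoeff k * x ^ (2 * k)

/-- The derivative of `besselJZeroTaylor n`. -/
noncomputable def besselJZeroTaylorDeriv (n : ℕ) (x : ℝ) : ℝ :=
  ∑ k ∈ Finset.range n, besselJZeroCoeff k * ((2 * k : ℕ) * x ^ (2 * k - 1))

theorem besselJZeroCoeff_succ (k : ℕ) :
    besselJZeroCoeff (k + 1) * (4 * (k + 1) ^ 2) = -besselJZeroCoeff k := by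
  have h : (k.factorial : ℝ) ≠ 0 := by positivity
  simp only [besselJZeroCoeff, Nat.factorial_succ, Nat.cast_mul, Nat.cast_succ]
  field_simp
  ring

theorem hasDerivAt_besselJZeroTaylor (n : ℕ) (x : ℝ) :
    HasDerivAt (besselJZeroTaylor n) (besselJZeroTaylorDeriv n x) x :=
  HasDerivAt.fun_sum fun k _ => (hasDerivAt_pow (2 * k) x).const_mul _

theorem hasDerivAt_mul_besselJZeroTaylorDeriv (n : ℕ) (x : ℝ) :
    HasDerivAt (fun x => x * besselJZeroTaylorDeriv (n + 1) x)
      (-(x * besselJZeroTaylor n x)) x := by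
  have h : (fun x => x * besselJZeroTaylorDeriv (n + 1) x) = fun x : ℝ =>
      ∑ k ∈ Finset.range n, besselJZeroCoeff (k + 1) * (2 * (k + 1)) * x ^ (2 * k + 2) := by
    funext y
    rw [besselJZeroTaylorDeriv, Finset.sum_range_succ', mul_add,
      Finset.mul_sum]
    simp only [mul_zero, Nat.cast_zero, zero_mul, add_zero]
    refine Finset.sum_congr rfl fun k _ => ?_
    rw [show 2 * (k + 1) - 1 = 2 * k + 1 by omega]
    push_cast
    ring
  rw [h]
  refine (HasDerivAt.fun_sum fun k _ =>
    (hasDerivAt_pow (2 * k + 2) x).const_mul _).congr_deriv ?_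
  rw [besselJZeroTaylor, Finset.mul_sum, ← Finset.sum_neg_distrib]
  refine Finset.sum_congr rfl fun k _ => ?_
  rw [show 2 * k + 2 - 1 = 2 * k + 1 by omega]
  push_cast
  linear_combination x ^ (2 * k + 1) * besselJZeroCoeff_succ k

theorem besselJZeroDeriv_sub_taylor_nonneg {n : ℕ}
    (h : ∀ x, 0 ≤ x → 0 ≤ (-1) ^ n * (besselJ 0 x - besselJZeroTaylor n x))
    {x : ℝ} (hx : 0 ≤ x) :
    0 ≤ (-1) ^ (n + 1) * (besselJZeroDeriv x - besselJZeroTaylorDeriv (n + 1) x) := by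
  have key : 0 ≤ (-1) ^ (n + 1) *
      (x * besselJZeroDeriv x - x * besselJZeroTaylorDeriv (n + 1) x) := by
    refine nonneg_of_hasDerivAt_nonneg (fun y => ((hasDerivAt_mul_besselJZeroDeriv y).sub
      (hasDerivAt_mul_besselJZeroTaylorDeriv n y)).const_mul _) (by simp) (fun y hy => ?_) hx
    rw [pow_succ]
    linarith [mul_nonneg hy (h y hy)]
  rcases hx.eq_or_lt with rfl | hx
  · have : besselJZeroTaylorDeriv (n + 1) 0 = 0 := Finset.sum_eq_zero fun k _ => by
      rcases k with _ | k
      · simp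
      · simp [show 2 * (k + 1) - 1 = 2 * k + 1 by omega]
    simp [besselJZeroDeriv_zero, this]
  · refine nonneg_of_mul_nonneg_right (key.trans_eq ?_) hx
    ring

/-- The Taylor polynomials of `besselJ 0` alternately bound it from above and below. -/
theorem besselJ_zero_sub_taylor_nonneg (n : ℕ) {x : ℝ} (hx : 0 ≤ x) :
    0 ≤ (-1) ^ (n + 1) * (besselJ 0 x - besselJZeroTaylor (n + 1) x) := by
  induction n generalizing x with
  | zero => simpa [besselJZeroTaylor, besselJZeroCoeff] using besselJ_zero_le_one x
  | succ n ih =>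
    refine nonneg_of_hasDerivAt_nonneg (fun y => ((hasDerivAt_besselJ_zero y).sub
      (hasDerivAt_besselJZeroTaylor (n + 2) y)).const_mul _) ?_
      (fun y hy => besselJZeroDeriv_sub_taylor_nonneg (fun z hz => ih hz) hy) hx
    simp [besselJ_zero_zero, besselJZeroTaylor, Finset.sum_range_succ', besselJZeroCoeff]

theorem besselJ_zero_nonneg {x : ℝ} (hx : 0 ≤ x) (hx2 : x ≤ 2) : 0 ≤ besselJ 0 x := by
  have h := besselJ_zero_sub_taylor_nonneg 1 hx
  norm_num [besselJZeroTaylor, besselJZeroCoeff, Finset.sum_range_succ, Nat.factorial] at h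
  nlinarith

theorem besselJ_zero_le {x : ℝ} (hx : 0 ≤ x) :
    besselJ 0 x ≤ 1 - x ^ 2 / 4 + x ^ 4 / 64 - x ^ 6 / 2304 + x ^ 8 / 147456 := by
  have h := besselJ_zero_sub_taylor_nonneg 4 hx
  norm_num [besselJZeroTaylor, besselJZeroCoeff, Finset.sum_range_succ, Nat.factorial] at h
  linarith

theorem besselJ_zero_two_mem : besselJ 0 2 ∈ Set.Icc 0.222 0.224 := by
  have h := besselJ_zero_sub_taylor_nonneg 3 (x := 2) (by norm_num)
  have h' := besselJ_zero_sub_taylor_nonneg 4 (x := 2) (by norm_num)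
  norm_num [besselJZeroTaylor, besselJZeroCoeff, Finset.sum_range_succ, Nat.factorial] at h h'
  constructor <;> linarith

theorem besselJZeroDeriv_two_mem : besselJZeroDeriv 2 ∈ Set.Icc (-0.584) (-0.576) := by
  have h := besselJZeroDeriv_sub_taylor_nonneg (n := 3) (x := 2)
    (fun x hx => besselJ_zero_sub_taylor_nonneg 2 hx) (by norm_num)
  have h' := besselJZeroDeriv_sub_taylor_nonneg (n := 4) (x := 2)
    (fun x hx => besselJ_zero_sub_taylor_nonneg 3 hx) (by norm_num)
  norm_num [besselJZeroTaylorDeriv, besselJZeroCoeff, Finset.sum_range_succ, Nat.factorial] at h h'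
  constructor <;> linarith

/-- On `[0, 2]`, the bound `x p(x)³ ≤ 0.7858³` for the Taylor polynomial `p`. The expression
increases and then decreases, with its maximum in `[0.7836, 0.7837]`. -/
theorem mul_taylor_cube_le {x : ℝ} (hx : 0 ≤ x) (hx2 : x ≤ 2) :
    x * (1 - x ^ 2 / 4 + x ^ 4 / 64 - x ^ 6 / 2304 + x ^ 8 / 147456) ^ 3 ≤ 0.7858 ^ 3 := by
  set F : ℝ → ℝ :=
    fun x => x * (1 - x ^ 2 / 4 + x ^ 4 / 64 - x ^ 6 / 2304 + x ^ 8 / 147456) ^ 3 with hF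
  set p : ℝ → ℝ :=
    fun x => 1 - x ^ 2 / 4 + x ^ 4 / 64 - x ^ 6 / 2304 + x ^ 8 / 147456 with hp
  set q : ℝ → ℝ := fun x =>
    1 - 7 * x ^ 2 / 4 + 13 * x ^ 4 / 64 - 19 * x ^ 6 / 2304 + 25 * x ^ 8 / 147456 with hq
  have hd (x : ℝ) : HasDerivAt F (p x ^ 2 * q x) x := by
    have h1 : HasDerivAt p (-x / 2 + x ^ 3 / 16 - x ^ 5 / 384 + x ^ 7 / 18432) x :=
      ((((((hasDerivAt_pow 2 x).div_const 4).const_sub 1).add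
        ((hasDerivAt_pow 4 x).div_const 64)).sub ((hasDerivAt_pow 6 x).div_const 2304)).add
        ((hasDerivAt_pow 8 x).div_const 147456)).congr_deriv (by norm_num; ring)
    exact ((hasDerivAt_id' x).mul (h1.pow 3)).congr_deriv (by simp [hp, hq]; ring)
  have hc (s : Set ℝ) : ContinuousOn F s := fun y _ => (hd y).continuousAt.continuousWithinAt
  have hinc : MonotoneOn F (Set.Icc 0 0.7836) := by
    refine monotoneOn_of_hasDerivWithinAt_nonneg (convex_Icc _ _) (hc _)
      (fun y _ => (hd y).hasDerivWithinAt) fun y hy => mul_nonneg (sq_nonneg _) ?_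
    obtain ⟨h0, h1⟩ := interior_subset hy
    have hz : y ^ 2 ≤ 0.61403 := by nlinarith
    have hz0 := sq_nonneg y
    simp only [hq, show y ^ 4 = (y ^ 2) ^ 2 by ring, show y ^ 6 = (y ^ 2) ^ 3 by ring,
      show y ^ 8 = (y ^ 2) ^ 4 by ring]
    generalize y ^ 2 = z at hz hz0
    nlinarith [mul_nonneg hz0 (sub_nonneg.2 hz), pow_nonneg hz0 3, pow_nonneg hz0 4,
      mul_nonneg (sq_nonneg z) (sub_nonneg.2 hz)]
  have hdec : AntitoneOn F (Set.Icc 0.7837 2) := by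
    refine antitoneOn_of_hasDerivWithinAt_nonpos (convex_Icc _ _) (hc _)
      (fun y _ => (hd y).hasDerivWithinAt) fun y hy =>
        mul_nonpos_of_nonneg_of_nonpos (sq_nonneg _) ?_
    obtain ⟨h0, h1⟩ := interior_subset hy
    have hz : y ^ 2 ≤ 4 := by nlinarith
    have hz0 : 0.614185 ≤ y ^ 2 := by nlinarith
    simp only [hq, show y ^ 4 = (y ^ 2) ^ 2 by ring, show y ^ 6 = (y ^ 2) ^ 3 by ring,
      show y ^ 8 = (y ^ 2) ^ 4 by ring]
    generalize y ^ 2 = z at hz hz0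
    have hlow : 25 * z ^ 4 / 147456 - 19 * z ^ 3 / 2304 ≤ 25 * z ^ 3 / 36864 - 19 * z ^ 3 / 2304 := by
      nlinarith [mul_nonneg (pow_nonneg (by linarith : 0 ≤ z) 3) (sub_nonneg.2 hz)]
    nlinarith [mul_nonneg (sub_nonneg.2 hz0) (sub_nonneg.2 hz), pow_nonneg (by linarith : 0 ≤ z) 3]
  change F x ≤ _
  rcases le_total x 0.7836 with h | h
  · refine (hinc ⟨hx, h⟩ ⟨by norm_num, le_rfl⟩ h).trans ?_
    norm_num [hF]
  rcases le_total x 0.7837 with h' | h'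
  · have hpx : p x ≤ 0.85229 := by
      have h2 : 0.7836 ^ 2 ≤ x ^ 2 := by gcongr
      have h4 : x ^ 4 ≤ 0.7837 ^ 4 := by gcongr
      have h6 : 0.7836 ^ 6 ≤ x ^ 6 := by gcongr
      have h8 : x ^ 8 ≤ 0.7837 ^ 8 := by gcongr
      norm_num at h2 h4 h6 h8
      simp only [hp]
      linarith
    calc x * p x ^ 3 ≤ x * 0.85229 ^ 3 :=
          mul_le_mul_of_nonneg_left ((Odd.pow_le_pow (n := 3) (by decide)).2 hpx) hx
      _ ≤ 0.7837 * 0.85229 ^ 3 := by gcongr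
      _ ≤ 0.7858 ^ 3 := by norm_num
  · refine (hdec ⟨le_rfl, by norm_num⟩ ⟨h', hx2⟩ h').trans ?_
    norm_num [hF]

/-- The energy `(u')² + (1 + 1 / (4 x²)) u²` of `u = √x J₀` is antitone, which bounds `x J₀²` for
`2 ≤ x` by the value of the energy at `2`. -/
theorem mul_besselJ_zero_sq_le {x : ℝ} (hx : 2 ≤ x) : x * besselJ 0 x ^ 2 ≤ 0.7 := by
  set J := besselJ 0
  set V : ℝ → ℝ := fun y => y * besselJZeroDeriv y
  have hE : AntitoneOn (fun y => y * J y ^ 2 + (V y ^ 2 + V y * J y + J y ^ 2 / 2) / y)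
      (Set.Ici 2) := by
    have hd (y : ℝ) (hy : 0 < y) :
        HasDerivAt (fun y => y * J y ^ 2 + (V y ^ 2 + V y * J y + J y ^ 2 / 2) / y)
          (-(J y ^ 2 / (2 * y ^ 2))) y := by
      have hJ : HasDerivAt J (V y / y) y :=
        (hasDerivAt_besselJ_zero y).congr_deriv (by simp only [V]; field_simp)
      have hV : HasDerivAt V (-(y * J y)) y := hasDerivAt_mul_besselJZeroDeriv y
      refine (((hasDerivAt_id' y).mul (hJ.pow 2)).add ((((hV.pow 2).add (hV.mul hJ)).add
        ((hJ.pow 2).div_const 2)).div (hasDerivAt_id' y) hy.ne')).congr_deriv ?_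
      simp
      field_simp
      ring
    refine antitoneOn_of_hasDerivWithinAt_nonpos (convex_Ici _)
      (fun y hy => (hd y (by linarith [Set.mem_Ici.1 hy])).continuousAt.continuousWithinAt)
      (fun y hy => (hd y (by linarith [Set.mem_Ici.1 (interior_subset hy)])).hasDerivWithinAt)
      fun y hy => ?_
    rw [neg_nonpos]
    positivity
  have h := hE Set.self_mem_Ici hx hx
  have hpos : 0 ≤ (V x ^ 2 + V x * J x + J x ^ 2 / 2) / x :=
    div_nonneg (by nlinarith [sq_nonneg (V x + J x / 2), sq_nonneg (J x)]) (by linarith)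
  obtain ⟨h1, h2⟩ : J 2 ∈ _ := besselJ_zero_two_mem
  obtain ⟨h3, h4⟩ := besselJZeroDeriv_two_mem
  simp only [V] at h hpos
  nlinarith

/-- Landau's bound. -/
theorem abs_besselJ_zero_le {x : ℝ} (hx : 0 < x) :
    |besselJ 0 x| ≤ 0.7858 * x ^ (-(1 / 3) : ℝ) := by
  have hr : 0 < x ^ (1 / 3 : ℝ) := by positivity
  have hr3 : (x ^ (1 / 3 : ℝ)) ^ 3 = x := by
    rw [← Real.rpow_natCast, ← Real.rpow_mul hx.le]
    norm_num
  rw [Real.rpow_neg hx.le, ← div_eq_mul_inv, le_div_iff₀ hr]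
  generalize x ^ (1 / 3 : ℝ) = r at hr hr3
  rcases le_total x 2 with h | h
  · refine le_of_pow_le_pow_left₀ three_ne_zero (by norm_num) ?_
    rw [mul_pow, hr3, abs_of_nonneg (besselJ_zero_nonneg hx.le h), mul_comm]
    refine le_trans ?_ (mul_taylor_cube_le hx.le h)
    gcongr
    · exact besselJ_zero_nonneg hx.le h
    · exact besselJ_zero_le hx.le
  · refine le_of_pow_le_pow_left₀ two_ne_zero (by norm_num) ?_
    have hE := mul_besselJ_zero_sq_le h
    have hr1 : 1.25 ≤ r := by
      by_contra! hlt
      have := pow_lt_pow_left₀ hlt hr.le three_ne_zero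
      norm_num at this
      linarith
    rw [mul_pow, sq_abs]
    have hmul := mul_le_mul_of_nonneg_right hr1 (by positivity : 0 ≤ besselJ 0 x ^ 2 * r ^ 2)
    have hrew : r * (besselJ 0 x ^ 2 * r ^ 2) = x * besselJ 0 x ^ 2 := by
      rw [← hr3]
      ring
    linarith

/-- Channel-estimation error bound for the circular UA. -/
theorem stmt6 (U : ℕ) (hU : 2 ≤ U) (c : ℝ) (hc : 0 < c)
    (X : Fin U → EuclideanSpace ℝ (Fin 2)) (dmin : ℝ) (hdmin : 0 < dmin)
    (hsep : ∀ k j, k ≠ j → dmin ≤ dist (X k) (X j)) (u : Fin U) :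
    |(|∑ v, besselJ 0 (c * dist (X v) (X u))| - 1)|
      ≤ 0.7858 * (U - 1 : ℕ) * (c * dmin) ^ (-(1/3) : ℝ) := by
  have hsplit : ∑ v, besselJ 0 (c * dist (X v) (X u)) =
      1 + ∑ v ∈ Finset.univ.erase u, besselJ 0 (c * dist (X v) (X u)) := by
    rw [← Finset.add_sum_erase _ _ (Finset.mem_univ u)]
    simp [besselJ_zero_zero]
  have hterm : ∀ v ∈ Finset.univ.erase u,
      |besselJ 0 (c * dist (X v) (X u))| ≤ 0.7858 * (c * dmin) ^ (-(1/3) : ℝ) := by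
    intro v hv
    have hd := hsep v u (Finset.ne_of_mem_erase hv)
    have hle : c * dmin ≤ c * dist (X v) (X u) := by gcongr
    have hpos : 0 < c * dmin := by positivity
    refine (abs_besselJ_zero_le (hpos.trans_le hle)).trans ?_
    exact mul_le_mul_of_nonneg_left
      (Real.rpow_le_rpow_of_nonpos hpos hle (by norm_num)) (by norm_num)
  have hsum := (Finset.abs_sum_le_sum_abs _ _).trans (Finset.sum_le_card_nsmul _ _ _ hterm)
  rw [Finset.card_erase_of_mem (Finset.mem_univ u), Finset.card_univ, Fintype.card_fin,
    nsmul_eq_mul] at hsum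
  calc |(|∑ v, besselJ 0 (c * dist (X v) (X u))| - 1)|
      = |(|∑ v, besselJ 0 (c * dist (X v) (X u))| - |1|)| := by rw [abs_one]
    _ ≤ |∑ v, besselJ 0 (c * dist (X v) (X u)) - 1| := abs_abs_sub_abs_le _ _
    _ = |∑ v ∈ Finset.univ.erase u, besselJ 0 (c * dist (X v) (X u))| := by
      rw [hsplit, add_sub_cancel_left]
    _ ≤ _ := hsum.trans_eq (by ring)
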